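/- arXiv:1707.02595 — 2 statements merged into one kernel-verified Lean document; each statement's English description precedes it below -/
import Mathlib

section
/- (Main Theorem.) Let C > 0 be arbitrary and let u : ℝ × ℝ → ℝ be a C² solution of the Born–Infeld equation satisfying the regularity/decay and smallness hypotheses with ε > 0 sufficiently small. Then, with the time-dependent interval I(t) := ( -C t/(log t)², C t/(log t)² ) for t ≥ 2, one has lim_{t→+∞} ∫_{I(t)} ( (∂ₓu)² + (∂ₜu)² )(t,x) dx = 0. -/
open MeasureTheory Real Filter

/-- Time derivative `∂ₜ u` of a scalar field `u : ℝ × ℝ → ℝ` (first variable is time). -/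
noncomputable def ut (u : ℝ × ℝ → ℝ) (t x : ℝ) : ℝ := deriv (fun s => u (s, x)) t

/-- Space derivative `∂ₓ u`. -/
noncomputable def ux (u : ℝ × ℝ → ℝ) (t x : ℝ) : ℝ := deriv (fun y => u (t, y)) x

/-- `∂ₜ² u`. -/
noncomputable def utt (u : ℝ × ℝ → ℝ) (t x : ℝ) : ℝ := deriv (fun s => ut u s x) t

/-- `∂ₓ² u`. -/
noncomputable def uxx (u : ℝ × ℝ → ℝ) (t x : ℝ) : ℝ := deriv (fun y => ux u t y) x

/-- Mixed derivative `∂²ₜₓ u`. -/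
noncomputable def utx (u : ℝ × ℝ → ℝ) (t x : ℝ) : ℝ := deriv (fun s => ux u s x) t

/-- The Born–Infeld equation in 1+1 dimensions:
`(1 - (∂ₜu)²) ∂ₓ²u + 2 ∂ₓu ∂ₜu ∂²ₜₓu - (1 + (∂ₓu)²) ∂ₜ²u = 0`. -/
def IsBISol (u : ℝ × ℝ → ℝ) : Prop :=
  ∀ t x : ℝ,
    (1 - (ut u t x) ^ 2) * uxx u t x
      + 2 * ux u t x * ut u t x * utx u t x
      - (1 + (ux u t x) ^ 2) * utt u t x = 0

/-- The scaling function `λ(t) = C t / (log t)²`. -/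
noncomputable def lam (C t : ℝ) : ℝ := C * t / (Real.log t) ^ 2

/-- Hyperbolic secant. -/
noncomputable def sech (x : ℝ) : ℝ := 1 / Real.cosh x

/-! ### Compactly supported weights -/

lemma hasDerivAt_max_zero_sq (z : ℝ) :
    HasDerivAt (fun z : ℝ => (max 0 z) ^ 2) (2 * max 0 z) z := by
  rcases lt_trichotomy z 0 with hz | rfl | hz
  · have h : (fun z : ℝ => (max 0 z) ^ 2) =ᶠ[nhds z] fun _ => 0 := by
      filter_upwards [gt_mem_nhds hz] with y hy
      simp [max_eq_left hy.le]
    simpa [max_eq_left hz.le] using (hasDerivAt_const z (0 : ℝ)).congr_of_eventuallyEq h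
  · have h : (fun z : ℝ => (max 0 z) ^ 2) =O[nhds 0] fun z : ℝ => z ^ 2 := by
      refine Asymptotics.IsBigO.of_bound 1 (Eventually.of_forall fun y => ?_)
      rcases le_total y 0 with hy | hy <;> simp [hy, sq_nonneg]
    have h' := h.trans_isLittleO (Asymptotics.isLittleO_pow_id (𝕜 := ℝ) one_lt_two)
    rw [hasDerivAt_iff_isLittleO_nhds_zero]
    simpa using h'
  · have h : (fun z : ℝ => (max 0 z) ^ 2) =ᶠ[nhds z] fun z => z ^ 2 := by
      filter_upwards [lt_mem_nhds hz] with y hy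
      simp [max_eq_right hy.le]
    simpa [max_eq_right hz.le] using (hasDerivAt_pow 2 z).congr_of_eventuallyEq h

/-- The parabolic cutoff supported on `[-1/2, 1/2]`. -/
noncomputable def cutoff (y : ℝ) : ℝ := max 0 (1 / 4 - y ^ 2)

lemma continuous_cutoff : Continuous cutoff := by
  unfold cutoff; fun_prop

lemma cutoff_nonneg (y : ℝ) : 0 ≤ cutoff y := le_max_left _ _

lemma cutoff_le (y : ℝ) : cutoff y ≤ 1 / 4 :=
  max_le (by norm_num) (by nlinarith [sq_nonneg y])

lemma cutoff_eq_zero {y : ℝ} (hy : 1 / 2 < |y|) : cutoff y = 0 := by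
  refine max_eq_left ?_
  rw [← sq_abs]
  nlinarith

lemma le_cutoff {y : ℝ} (hy : |y| ≤ 1 / 4) : 3 / 16 ≤ cutoff y := by
  refine le_max_of_le_right ?_
  rw [← sq_abs]
  nlinarith [abs_nonneg y]

lemma hasDerivAt_cutoff_sq (y : ℝ) :
    HasDerivAt (fun y => cutoff y ^ 2) (-(4 * y * cutoff y)) y := by
  have h : HasDerivAt (fun y : ℝ => 1 / 4 - y ^ 2) (-(2 * y)) y := by
    exact ((hasDerivAt_pow 2 y).const_sub (1 / 4)).congr_deriv (by simp)
  refine ((hasDerivAt_max_zero_sq (1 / 4 - y ^ 2)).comp y h).congr_deriv ?_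
  unfold cutoff
  ring

lemma exists_bounded_primitive {g : ℝ → ℝ} (hg : Continuous g) (hi : Integrable g) :
    ∃ φ : ℝ → ℝ, (∀ y, HasDerivAt φ (g y) y) ∧ ∃ M, ∀ y, |φ y| ≤ M := by
  refine ⟨fun y => ∫ x in (0 : ℝ)..y, g x,
    fun y => intervalIntegral.integral_hasDerivAt_right (hg.intervalIntegrable _ _)
      hg.stronglyMeasurable.stronglyMeasurableAtFilter hg.continuousAt,
    ∫ x, ‖g x‖, fun y => ?_⟩
  exact intervalIntegral.norm_integral_le_integral_norm_uIoc.trans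
    (setIntegral_le_integral hi.norm (Eventually.of_forall fun _ => norm_nonneg _))

/-! ### Weighted balance laws -/

lemma Continuous.integrable_of_forall_lt_abs {f : ℝ → ℝ} (hf : Continuous f) {R : ℝ}
    (h : ∀ x, R < |x| → f x = 0) : Integrable f := by
  refine hf.integrable_of_hasCompactSupport
    (HasCompactSupport.intro (isCompact_Icc (a := -R) (b := R)) fun x hx => h x ?_)
  by_contra! hR
  exact hx (abs_le.1 hR)

lemma hasDerivAt_integral_of_forall_lt_abs {f f' : ℝ → ℝ → ℝ} {t a b R : ℝ}
    (ht : t ∈ Set.Ioo a b)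
    (hf : ∀ s ∈ Set.Icc a b, ∀ x, HasDerivAt (fun s => f s x) (f' s x) s)
    (hfc : ∀ s ∈ Set.Icc a b, Continuous (f s))
    (hc : ContinuousOn (Function.uncurry f') (Set.Icc a b ×ˢ Set.univ))
    (h0 : ∀ s ∈ Set.Icc a b, ∀ x, R < |x| → f s x = 0)
    (h0' : ∀ s ∈ Set.Icc a b, ∀ x, R < |x| → f' s x = 0) :
    HasDerivAt (fun s => ∫ x, f s x) (∫ x, f' t x) t := by
  obtain ⟨K, hK⟩ := (isCompact_Icc.prod (isCompact_Icc (a := -R) (b := R))).exists_bound_of_continuousOn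
    (hc.mono (Set.prod_mono_right (Set.subset_univ _)))
  have hmem := Set.Ioo_subset_Icc_self ht
  have hc' : Continuous (f' t) := by
    rw [← continuousOn_univ]
    exact hc.comp (f := fun x => (t, x)) (by fun_prop) fun x _ => ⟨hmem, trivial⟩
  refine (hasDerivAt_integral_of_dominated_loc_of_deriv_le (F := f) (F' := f')
    (bound := (Set.Icc (-R) R).indicator fun _ => K) (Ioo_mem_nhds ht.1 ht.2) ?_
    ((hfc t hmem).integrable_of_forall_lt_abs (h0 t hmem))
    hc'.aestronglyMeasurable (Eventually.of_forall fun x s hs => ?_) ?_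
    (Eventually.of_forall fun x s hs => hf s (Set.Ioo_subset_Icc_self hs) x)).2
  · filter_upwards [Ioo_mem_nhds ht.1 ht.2] with s hs
    exact (hfc s (Set.Ioo_subset_Icc_self hs)).aestronglyMeasurable
  · have hs' := Set.Ioo_subset_Icc_self hs
    by_cases hx : x ∈ Set.Icc (-R) R
    · rw [Set.indicator_of_mem hx]
      exact hK (s, x) ⟨hs', hx⟩
    · rw [Set.indicator_of_notMem hx, h0' s hs' x, norm_zero]
      by_contra! hR
      exact hx (abs_le.1 hR)
  · exact (integrable_indicator_iff measurableSet_Icc).2 (by simp)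

/-- Self-similar weighted form of the balance law `∂ₜ e = ∂ₓ p`, whose two sides are `h`. -/
lemma hasDerivAt_integral_weight_mul {w w' : ℝ → ℝ} {e p h : ℝ → ℝ → ℝ}
    (hw : ∀ y, HasDerivAt w (w' y) y) (hw' : Continuous w')
    (he : Continuous (Function.uncurry e)) (hp : Continuous (Function.uncurry p))
    (hh : Continuous (Function.uncurry h))
    (het : ∀ t x, HasDerivAt (fun s => e s x) (h t x) t)
    (hpx : ∀ t x, HasDerivAt (fun y => p t y) (h t x) x)
    (hs : ∀ T : ℝ, ∃ R : ℝ, ∀ t x : ℝ, |t| ≤ T → R ≤ |x| → e t x = 0 ∧ p t x = 0)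
    {t : ℝ} (ht : 0 < t) :
    HasDerivAt (fun s => ∫ x, w (x / s) * e s x)
      (-(1 / t * ∫ x, w' (x / t) * (p t x + x / t * e t x))) t := by
  obtain ⟨R, hR⟩ := hs (2 * t)
  have hwc : Continuous w := continuous_iff_continuousAt.2 fun y => (hw y).continuousAt
  have hT : ∀ s ∈ Set.Icc (t / 2) (2 * t), 0 < s ∧ |s| ≤ 2 * t := fun s hs =>
    ⟨by linarith [hs.1], abs_le.2 ⟨by linarith [hs.1], hs.2⟩⟩
  have htm : t ∈ Set.Icc (t / 2) (2 * t) := ⟨by linarith, by linarith⟩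
  have hh0 : ∀ s ∈ Set.Icc (t / 2) (2 * t), ∀ x, R < |x| → h s x = 0 := by
    intro s hs x hx
    have h0 : (fun y => p s y) =ᶠ[nhds x] fun _ => 0 := by
      filter_upwards [continuous_abs.continuousAt.eventually (lt_mem_nhds hx)] with y hy
      exact (hR s y (hT s hs).2 (le_of_lt hy)).2
    exact (hpx s x).unique ((hasDerivAt_const x (0 : ℝ)).congr_of_eventuallyEq h0)
  have hec : ∀ s, Continuous (e s) := fun s => he.comp (by fun_prop : Continuous fun x => (s, x))
  have hpc : ∀ s, Continuous (p s) := fun s => hp.comp (by fun_prop : Continuous fun x => (s, x))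
  have hhc : ∀ s, Continuous (h s) := fun s => hh.comp (by fun_prop : Continuous fun x => (s, x))
  have key := hasDerivAt_integral_of_forall_lt_abs (R := R)
    (f := fun s x => w (x / s) * e s x)
    (f' := fun s x => w (x / s) * h s x - x / s ^ 2 * w' (x / s) * e s x)
    (t := t) (a := t / 2) (b := 2 * t) ⟨by linarith, by linarith⟩ ?_ ?_ ?_ ?_ ?_
  · refine key.congr_deriv ?_
    have hd : ∀ x, HasDerivAt (fun y => w (y / t) * p t y)
        (1 / t * w' (x / t) * p t x + w (x / t) * h t x) x := by
      intro x
      refine (((hw (x / t)).comp x ((hasDerivAt_id x).div_const t)).mul (hpx t x)).congr_deriv ?_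
      simp only [Function.comp, id]
      ring
    have hi : Integrable fun x => 1 / t * w' (x / t) * p t x + w (x / t) * h t x := by
      refine Continuous.integrable_of_forall_lt_abs (R := R) ?_ fun x hx => ?_
      · have := hpc t; have := hhc t; fun_prop
      · rw [hh0 t htm x hx, (hR t x (hT t htm).2 hx.le).2]; ring
    have hi' : Integrable fun x => w' (x / t) * (p t x + x / t * e t x) := by
      refine Continuous.integrable_of_forall_lt_abs (R := R) ?_ fun x hx => ?_
      · have := hpc t; have := hec t; fun_prop
      · rw [(hR t x (hT t htm).2 hx.le).1, (hR t x (hT t htm).2 hx.le).2]; ring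
    have hi0 : Integrable fun x => w (x / t) * p t x := by
      refine Continuous.integrable_of_forall_lt_abs (R := R) ?_ fun x hx => ?_
      · have := hpc t; fun_prop
      · rw [(hR t x (hT t htm).2 hx.le).2]; ring
    have hz := integral_eq_zero_of_hasDerivAt_of_integrable hd hi hi0
    rw [← integral_const_mul, ← zero_sub, ← hz, ← integral_sub hi (hi'.const_mul _)]
    congr 1 with x
    field_simp
    ring
  · intro s hs x
    have hs0 := (hT s hs).1
    have hq : HasDerivAt (fun s => x / s) (-(x / s ^ 2)) s := by
      simpa [div_eq_mul_inv] using (hasDerivAt_inv hs0.ne').const_mul x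
    refine (((hw (x / s)).comp s hq).mul (het s x)).congr_deriv ?_
    simp only [Function.comp]
    ring
  · intro s hs
    have := hec s
    fun_prop
  · have hne : ∀ z ∈ Set.Icc (t / 2) (2 * t) ×ˢ (Set.univ : Set ℝ), z.1 ≠ 0 :=
      fun z hz => (hT z.1 hz.1).1.ne'
    have hne2 : ∀ z ∈ Set.Icc (t / 2) (2 * t) ×ˢ (Set.univ : Set ℝ), z.1 ^ 2 ≠ 0 :=
      fun z hz => pow_ne_zero 2 (hne z hz)
    have hdiv : ContinuousOn (fun z : ℝ × ℝ => z.2 / z.1)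
        (Set.Icc (t / 2) (2 * t) ×ˢ Set.univ) := continuousOn_snd.div continuousOn_fst hne
    exact ((hwc.comp_continuousOn hdiv).mul hh.continuousOn).sub
      (((continuousOn_snd.div (continuousOn_fst.pow 2) hne2).mul
        (hw'.comp_continuousOn hdiv)).mul he.continuousOn)
  · intro s hs x hx
    simp [(hR s x (hT s hs).2 hx.le).1]
  · intro s hs x hx
    simp [(hR s x (hT s hs).2 hx.le).1, hh0 s hs x hx]

/-! ### Monotone functionals -/

lemma exists_tendsto_atTop_of_antitoneOn_Ioi {f : ℝ → ℝ} (hf : AntitoneOn f (Set.Ioi 0)) {m : ℝ}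
    (hm : ∀ t, 0 < t → m ≤ f t) : ∃ l, Tendsto f atTop (nhds l) := by
  have hpos : ∀ t : ℝ, 0 < max t 1 := fun t => zero_lt_one.trans_le (le_max_right _ _)
  have ha : Antitone fun t => f (max t 1) := fun s t hst =>
    hf (hpos s) (hpos t) (max_le_max_right 1 hst)
  refine ⟨_, (tendsto_atTop_ciInf ha ⟨m, ?_⟩).congr' ?_⟩
  · rintro _ ⟨t, rfl⟩
    exact hm _ (hpos t)
  · filter_upwards [eventually_ge_atTop 1] with t ht
    simp [max_eq_left ht]

lemma antitoneOn_Ioi_of_hasDerivAt_nonpos {f f' : ℝ → ℝ} {a : ℝ}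
    (hf : ∀ t, a < t → HasDerivAt f (f' t) t) (hf' : ∀ t, a < t → f' t ≤ 0) :
    AntitoneOn f (Set.Ioi a) := by
  refine antitoneOn_of_deriv_nonpos (convex_Ioi a)
    (fun t ht => (hf t ht).continuousAt.continuousWithinAt) ?_ ?_ <;> rw [interior_Ioi]
  · exact fun t ht => (hf t ht).differentiableAt.differentiableWithinAt
  · exact fun t ht => (hf t ht).deriv ▸ hf' t ht

/-- If the bounded functional `A` decreases at rate at least `c Q / t`, while `B ≤ Q` grows at
rate at most `K Q / t`, then `B` tends to zero. -/
lemma tendsto_zero_of_virial {A A' B B' Q : ℝ → ℝ} {M c K : ℝ} (hc : 0 < c) (hK : 0 ≤ K)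
    (hA : ∀ t, 0 < t → HasDerivAt A (A' t) t) (hB : ∀ t, 0 < t → HasDerivAt B (B' t) t)
    (hA' : ∀ t, 0 < t → A' t ≤ -(c * Q t / t)) (hB' : ∀ t, 0 < t → B' t ≤ K * Q t / t)
    (hB0 : ∀ t, 0 < t → 0 ≤ B t) (hBQ : ∀ t, 0 < t → B t ≤ Q t)
    (hM : ∀ t, 0 < t → |A t| ≤ M) : Tendsto B atTop (nhds 0) := by
  have hanti : AntitoneOn A (Set.Ioi 0) := antitoneOn_Ioi_of_hasDerivAt_nonpos hA fun t ht =>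
    (hA' t ht).trans (neg_nonpos.2 (div_nonneg
      (mul_nonneg hc.le ((hB0 t ht).trans (hBQ t ht))) ht.le))
  have hanti' : AntitoneOn (fun t => B t + K / c * A t) (Set.Ioi 0) := by
    refine antitoneOn_Ioi_of_hasDerivAt_nonpos
      (fun t ht => (hB t ht).add ((hA t ht).const_mul (K / c))) fun t ht => ?_
    have h1 := mul_le_mul_of_nonneg_left (hA' t ht) (div_nonneg hK hc.le)
    have h2 : K / c * -(c * Q t / t) = -(K * Q t / t) := by field_simp
    linarith [hB' t ht]
  obtain ⟨l, hl⟩ := exists_tendsto_atTop_of_antitoneOn_Ioi hanti fun t ht => (abs_le.1 (hM t ht)).1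
  obtain ⟨l', hl'⟩ := exists_tendsto_atTop_of_antitoneOn_Ioi (m := K / c * -M) hanti' fun t ht => by
    have := mul_le_mul_of_nonneg_left (abs_le.1 (hM t ht)).1 (div_nonneg hK hc.le)
    linarith [hB0 t ht]
  obtain ⟨b, hb⟩ : ∃ b, Tendsto B atTop (nhds b) :=
    ⟨l' - K / c * l, (hl'.sub (hl.const_mul (K / c))).congr fun t => by ring⟩
  have hb0 : 0 ≤ b := ge_of_tendsto hb ((eventually_gt_atTop 0).mono hB0)
  rcases hb0.eq_or_lt with rfl | hbpos
  · exact hb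
  exfalso
  obtain ⟨T, hT⟩ := eventually_atTop.1
    ((hb.eventually (lt_mem_nhds (half_lt_self hbpos))).and (eventually_gt_atTop 0))
  have hT0 : ∀ t, T < t → 0 < t := fun t ht => (hT t ht.le).2
  have hlog : AntitoneOn (fun t => A t + c * (b / 2) * Real.log t) (Set.Ioi T) := by
    refine antitoneOn_Ioi_of_hasDerivAt_nonpos
      (fun t ht => (hA t (hT0 t ht)).add
        ((Real.hasDerivAt_log (hT0 t ht).ne').const_mul (c * (b / 2)))) fun t ht => ?_
    have ht0 := hT0 t ht
    have hQ : b / 2 ≤ Q t := (hT t ht.le).1.le.trans (hBQ t ht0)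
    have h1 : c * (b / 2) * t⁻¹ ≤ c * Q t / t := by
      rw [← div_eq_mul_inv]
      gcongr
    linarith [hA' t ht0]
  have hlim : Tendsto (fun t => A t + c * (b / 2) * Real.log t) atTop atTop :=
    hl.add_atTop (Real.tendsto_log_atTop.const_mul_atTop (by positivity))
  obtain ⟨t, ht, htT⟩ := ((hlim.eventually_gt_atTop
    (A (T + 1) + c * (b / 2) * Real.log (T + 1))).and (eventually_ge_atTop (T + 1))).exists
  exact absurd (hlog (by simp : T + 1 ∈ Set.Ioi T) (by simp; linarith : t ∈ Set.Ioi T) htT)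
    (not_le.2 ht)

/-! ### Energy, momentum and stress of the Born-Infeld field -/

/-- The Born-Infeld Lagrangian `√(1 + a² - b²)` for `a = ∂ₓu`, `b = ∂ₜu`. -/
noncomputable def lagr (a b : ℝ) : ℝ := √(1 + a ^ 2 - b ^ 2)

/-- Energy density, normalized to vanish at the zero field. -/
noncomputable def energyDensity (a b : ℝ) : ℝ := (1 + a ^ 2) / lagr a b - 1

/-- Momentum density, which is also the energy flux. -/
noncomputable def momentumDensity (a b : ℝ) : ℝ := a * b / lagr a b

/-- Momentum flux, normalized to vanish at the zero field. -/
noncomputable def stressDensity (a b : ℝ) : ℝ := 1 - (1 - b ^ 2) / lagr a b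

section Pointwise

variable {a b : ℝ}

lemma one_add_sq_sub_sq_mem (h : |a| + |b| ≤ 1 / 10) :
    99 / 100 ≤ 1 + a ^ 2 - b ^ 2 ∧ 1 + a ^ 2 - b ^ 2 ≤ 101 / 100 := by
  have ha := abs_nonneg a
  have hb := abs_nonneg b
  rw [← sq_abs a, ← sq_abs b]
  constructor <;> nlinarith

lemma lagr_sq (h : |a| + |b| ≤ 1 / 10) : lagr a b ^ 2 = 1 + a ^ 2 - b ^ 2 :=
  Real.sq_sqrt (by linarith [(one_add_sq_sub_sq_mem h).1])

lemma lagr_mem (h : |a| + |b| ≤ 1 / 10) : 99 / 100 ≤ lagr a b ∧ lagr a b ≤ 101 / 100 := by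
  obtain ⟨h1, h2⟩ := one_add_sq_sub_sq_mem h
  constructor
  · exact Real.le_sqrt_of_sq_le (by linarith)
  · exact (Real.sqrt_le_left (by norm_num)).2 (by linarith)

lemma lagr_pos (h : |a| + |b| ≤ 1 / 10) : 0 < lagr a b := by linarith [(lagr_mem h).1]

lemma energyDensity_eq (h : |a| + |b| ≤ 1 / 10) :
    energyDensity a b = (a ^ 2 * lagr a b + b ^ 2) / (lagr a b * (lagr a b + 1)) := by
  have h0 := lagr_pos h
  have h1 := lagr_sq h
  unfold energyDensity
  field_simp
  linear_combination -h1

lemma stressDensity_eq (h : |a| + |b| ≤ 1 / 10) :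
    stressDensity a b = (a ^ 2 + lagr a b * b ^ 2) / (lagr a b * (lagr a b + 1)) := by
  have h0 := lagr_pos h
  have h1 := lagr_sq h
  unfold stressDensity
  field_simp
  linear_combination h1

lemma energyDensity_mem (h : |a| + |b| ≤ 1 / 10) :
    (a ^ 2 + b ^ 2) / 4 ≤ energyDensity a b ∧ energyDensity a b ≤ 53 / 100 * (a ^ 2 + b ^ 2) := by
  have h0 := lagr_pos h
  obtain ⟨h1, h2⟩ := lagr_mem h
  have h3 : lagr a b * (lagr a b + 1) ≤ 204 / 100 := by nlinarith
  have h4 : 197 / 100 ≤ lagr a b * (lagr a b + 1) := by nlinarith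
  rw [energyDensity_eq h, le_div_iff₀ (by positivity), div_le_iff₀ (by positivity)]
  constructor <;>
    nlinarith [mul_le_mul_of_nonneg_left h3 (sq_nonneg a), mul_le_mul_of_nonneg_left h3 (sq_nonneg b),
      mul_le_mul_of_nonneg_left h4 (sq_nonneg a), mul_le_mul_of_nonneg_left h4 (sq_nonneg b),
      mul_le_mul_of_nonneg_left h1 (sq_nonneg a), mul_le_mul_of_nonneg_left h2 (sq_nonneg a)]

lemma le_stressDensity (h : |a| + |b| ≤ 1 / 10) :
    48 / 100 * (a ^ 2 + b ^ 2) ≤ stressDensity a b := by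
  have h0 := lagr_pos h
  obtain ⟨h1, h2⟩ := lagr_mem h
  have h3 : lagr a b * (lagr a b + 1) ≤ 2031 / 1000 := by nlinarith
  rw [stressDensity_eq h, le_div_iff₀ (by positivity)]
  nlinarith [mul_le_mul_of_nonneg_left h3 (sq_nonneg a), mul_le_mul_of_nonneg_left h3 (sq_nonneg b),
    mul_le_mul_of_nonneg_left h1 (sq_nonneg b)]

lemma abs_momentumDensity_le (h : |a| + |b| ≤ 1 / 10) :
    |momentumDensity a b| ≤ 51 / 100 * (a ^ 2 + b ^ 2) := by
  have h0 := lagr_pos h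
  unfold momentumDensity
  rw [abs_div, abs_of_pos h0, div_le_iff₀ h0, abs_mul, ← sq_abs a, ← sq_abs b]
  nlinarith [mul_le_mul_of_nonneg_left (lagr_mem h).1 (add_nonneg (sq_nonneg |a|) (sq_nonneg |b|)),
    sq_nonneg (|a| - |b|)]

lemma le_stressDensity_add {y : ℝ} (h : |a| + |b| ≤ 1 / 10) (hy : |y| ≤ 1 / 2) :
    1 / 5 * (a ^ 2 + b ^ 2) ≤ stressDensity a b + y * momentumDensity a b := by
  have h1 : |y * momentumDensity a b| ≤ 1 / 2 * (51 / 100 * (a ^ 2 + b ^ 2)) := by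
    rw [abs_mul]
    exact mul_le_mul hy (abs_momentumDensity_le h) (abs_nonneg _) (by norm_num)
  linarith [le_stressDensity h, (abs_le.1 h1).1, sq_nonneg a, sq_nonneg b]

lemma abs_momentumDensity_add_le {y : ℝ} (h : |a| + |b| ≤ 1 / 10) (hy : |y| ≤ 1 / 2) :
    |momentumDensity a b + y * energyDensity a b| ≤ a ^ 2 + b ^ 2 := by
  obtain ⟨h1, h2⟩ := energyDensity_mem h
  have h3 : |energyDensity a b| ≤ 53 / 100 * (a ^ 2 + b ^ 2) := by
    rwa [abs_of_nonneg (le_trans (by positivity) h1)]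
  have h4 : |y * energyDensity a b| ≤ 1 / 2 * (53 / 100 * (a ^ 2 + b ^ 2)) := by
    rw [abs_mul]
    exact mul_le_mul hy h3 (abs_nonneg _) (by norm_num)
  linarith [abs_add_le (momentumDensity a b) (y * energyDensity a b), abs_momentumDensity_le h,
    sq_nonneg a, sq_nonneg b]

end Pointwise

section Derivatives

variable {f g : ℝ → ℝ} {f' g' x : ℝ}

lemma hasDerivAt_lagr (hf : HasDerivAt f f' x) (hg : HasDerivAt g g' x)
    (h : |f x| + |g x| ≤ 1 / 10) :
    HasDerivAt (fun y => lagr (f y) (g y)) ((f x * f' - g x * g') / lagr (f x) (g x)) x := by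
  refine ((((hf.pow 2).const_add 1).sub (hg.pow 2)).sqrt
    (by simpa using (by linarith [(one_add_sq_sub_sq_mem h).1] :
      (0 : ℝ) < 1 + f x ^ 2 - g x ^ 2).ne')).congr_deriv ?_
  have h0 := lagr_pos h
  simp only [Pi.sub_apply, Pi.pow_apply]
  rw [show √(1 + f x ^ 2 - g x ^ 2) = lagr (f x) (g x) from rfl]
  field_simp
  push_cast
  ring

lemma hasDerivAt_energyDensity (hf : HasDerivAt f f' x) (hg : HasDerivAt g g' x)
    (h : |f x| + |g x| ≤ 1 / 10) :
    HasDerivAt (fun y => energyDensity (f y) (g y))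
      (2 * f x * f' / lagr (f x) (g x)
        - (1 + f x ^ 2) * (f x * f' - g x * g') / lagr (f x) (g x) ^ 3) x := by
  have h0 := lagr_pos h
  refine ((((hf.pow 2).const_add 1).div (hasDerivAt_lagr hf hg h) h0.ne').sub_const 1).congr_deriv ?_
  simp only [Pi.pow_apply]
  field_simp
  push_cast
  ring

lemma hasDerivAt_momentumDensity (hf : HasDerivAt f f' x) (hg : HasDerivAt g g' x)
    (h : |f x| + |g x| ≤ 1 / 10) :
    HasDerivAt (fun y => momentumDensity (f y) (g y))
      ((f' * g x + f x * g') / lagr (f x) (g x)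
        - f x * g x * (f x * f' - g x * g') / lagr (f x) (g x) ^ 3) x := by
  have h0 := lagr_pos h
  refine ((hf.mul hg).div (hasDerivAt_lagr hf hg h) h0.ne').congr_deriv ?_
  simp only [Pi.mul_apply]
  field_simp

lemma hasDerivAt_stressDensity (hf : HasDerivAt f f' x) (hg : HasDerivAt g g' x)
    (h : |f x| + |g x| ≤ 1 / 10) :
    HasDerivAt (fun y => stressDensity (f y) (g y))
      (2 * g x * g' / lagr (f x) (g x)
        + (1 - g x ^ 2) * (f x * f' - g x * g') / lagr (f x) (g x) ^ 3) x := by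
  have h0 := lagr_pos h
  refine ((((hg.pow 2).const_sub 1).div (hasDerivAt_lagr hf hg h) h0.ne').const_sub 1).congr_deriv ?_
  simp only [Pi.pow_apply]
  field_simp
  push_cast
  ring

end Derivatives

lemma energy_balance {a b ax at' bt : ℝ} (h : |a| + |b| ≤ 1 / 10)
    (hpde : (1 - b ^ 2) * ax + 2 * a * b * at' - (1 + a ^ 2) * bt = 0) :
    2 * a * at' / lagr a b - (1 + a ^ 2) * (a * at' - b * bt) / lagr a b ^ 3
      = (ax * b + a * at') / lagr a b - a * b * (a * ax - b * at') / lagr a b ^ 3 := by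
  have h0 := lagr_pos h
  have h1 := lagr_sq h
  field_simp
  rw [h1]
  linear_combination (-b) * hpde

lemma momentum_balance {a b ax at' bt : ℝ} (h : |a| + |b| ≤ 1 / 10)
    (hpde : (1 - b ^ 2) * ax + 2 * a * b * at' - (1 + a ^ 2) * bt = 0) :
    (at' * b + a * bt) / lagr a b - a * b * (a * at' - b * bt) / lagr a b ^ 3
      = 2 * b * at' / lagr a b + (1 - b ^ 2) * (a * ax - b * at') / lagr a b ^ 3 := by
  have h0 := lagr_pos h
  have h1 := lagr_sq h
  field_simp
  rw [h1]
  linear_combination (-a) * hpde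

/-! ### Decay in a cone -/

lemma Continuous.lagr {X : Type*} [TopologicalSpace X] {a b : X → ℝ} (ha : Continuous a)
    (hb : Continuous b) : Continuous fun z => lagr (a z) (b z) := by
  unfold _root_.lagr; fun_prop

lemma tendsto_integral_cone_zero {a b ax at' bt : ℝ → ℝ → ℝ}
    (ha : Continuous (Function.uncurry a)) (hb : Continuous (Function.uncurry b))
    (hcax : Continuous (Function.uncurry ax)) (hcat : Continuous (Function.uncurry at'))
    (hax : ∀ t x, HasDerivAt (fun y => a t y) (ax t x) x)
    (hat : ∀ t x, HasDerivAt (fun s => a s x) (at' t x) t)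
    (hbx : ∀ t x, HasDerivAt (fun y => b t y) (at' t x) x)
    (hbt : ∀ t x, HasDerivAt (fun s => b s x) (bt t x) t)
    (hpde : ∀ t x, (1 - b t x ^ 2) * ax t x + 2 * a t x * b t x * at' t x
      - (1 + a t x ^ 2) * bt t x = 0)
    (hsmall : ∀ t x, |a t x| + |b t x| ≤ 1 / 10) {m : ℝ}
    (hint : ∀ t, ∫ x, (a t x ^ 2 + b t x ^ 2) ≤ m)
    (hs : ∀ T : ℝ, ∃ R : ℝ, ∀ t x : ℝ, |t| ≤ T → R ≤ |x| → a t x = 0 ∧ b t x = 0) :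
    Tendsto (fun t => ∫ x in Set.Icc (-(t / 4)) (t / 4), (a t x ^ 2 + b t x ^ 2))
      atTop (nhds 0) := by
  set q : ℝ → ℝ → ℝ := fun t x => a t x ^ 2 + b t x ^ 2 with hq
  set e : ℝ → ℝ → ℝ := fun t x => energyDensity (a t x) (b t x) with he
  set p : ℝ → ℝ → ℝ := fun t x => momentumDensity (a t x) (b t x) with hp
  set s : ℝ → ℝ → ℝ := fun t x => stressDensity (a t x) (b t x) with hs_def
  have hL : Continuous fun z : ℝ × ℝ => lagr (a z.1 z.2) (b z.1 z.2) := ha.lagr hb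
  have hL0 : ∀ z : ℝ × ℝ, lagr (a z.1 z.2) (b z.1 z.2) ≠ 0 := fun z => (lagr_pos (hsmall _ _)).ne'
  have hL3 : ∀ z : ℝ × ℝ, lagr (a z.1 z.2) (b z.1 z.2) ^ 3 ≠ 0 := fun z => pow_ne_zero 3 (hL0 z)
  have ha' : Continuous fun z : ℝ × ℝ => a z.1 z.2 := ha
  have hb' : Continuous fun z : ℝ × ℝ => b z.1 z.2 := hb
  have hcax' : Continuous fun z : ℝ × ℝ => ax z.1 z.2 := hcax
  have hcat' : Continuous fun z : ℝ × ℝ => at' z.1 z.2 := hcat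
  have hce : Continuous (Function.uncurry e) :=
    (((ha'.pow 2).const_add 1).div hL hL0).sub continuous_const
  have hcp : Continuous (Function.uncurry p) := (ha'.mul hb').div hL hL0
  have hcs : Continuous (Function.uncurry s) :=
    continuous_const.sub ((continuous_const.sub (hb'.pow 2)).div hL hL0)
  have hslice : ∀ {f : ℝ → ℝ → ℝ}, Continuous (Function.uncurry f) → ∀ t, Continuous (f t) :=
    fun hf t => hf.comp (by fun_prop : Continuous fun x => (t, x))
  have hcq : ∀ t, Continuous (q t) := fun t => ((hslice ha t).pow 2).add ((hslice hb t).pow 2)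
  have hsep : ∀ T : ℝ, ∃ R : ℝ, ∀ t x : ℝ, |t| ≤ T → R ≤ |x| → e t x = 0 ∧ p t x = 0 := by
    intro T
    obtain ⟨R, hR⟩ := hs T
    refine ⟨R, fun t x ht hx => ?_⟩
    simp [he, hp, energyDensity, momentumDensity, lagr, hR t x ht hx]
  have hsps : ∀ T : ℝ, ∃ R : ℝ, ∀ t x : ℝ, |t| ≤ T → R ≤ |x| → p t x = 0 ∧ s t x = 0 := by
    intro T
    obtain ⟨R, hR⟩ := hs T
    refine ⟨R, fun t x ht hx => ?_⟩
    simp [hs_def, hp, stressDensity, momentumDensity, lagr, hR t x ht hx]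
  have hq0 : ∀ t x, 0 ≤ q t x := fun t x => by positivity
  have hmul : ∀ (t : ℝ) {w : ℝ → ℝ} {f : ℝ → ℝ}, Continuous w → Continuous f →
      (∀ x, q t x = 0 → f x = 0) → Integrable fun x => w x * f x := by
    intro t w f hw hf h0
    obtain ⟨R, hR⟩ := hs |t|
    refine (hw.mul hf).integrable_of_forall_lt_abs (R := R) fun x hx => ?_
    have hz := hR t x le_rfl hx.le
    simp [h0 x (by simp [hq, hz.1, hz.2])]
  have hqi : ∀ t, Integrable (q t) := fun t => by
    simpa using hmul t (continuous_const (y := (1 : ℝ))) (hcq t) fun x => id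
  have hzero : ∀ t x, q t x = 0 → a t x = 0 ∧ b t x = 0 := fun t x h =>
    ⟨by nlinarith [sq_nonneg (a t x), sq_nonneg (b t x)],
      by nlinarith [sq_nonneg (a t x), sq_nonneg (b t x)]⟩
  have he0 : ∀ t x, q t x = 0 → e t x = 0 := fun t x h => by
    simp [he, energyDensity, lagr, hzero t x h]
  have hp0 : ∀ t x, q t x = 0 → p t x = 0 := fun t x h => by
    simp [hp, momentumDensity, hzero t x h]
  have hs0 : ∀ t x, q t x = 0 → s t x = 0 := fun t x h => by
    simp [hs_def, stressDensity, lagr, hzero t x h]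
  have hg := continuous_cutoff
  obtain ⟨φ, hφ, M, hM⟩ := exists_bounded_primitive hg
    (hg.integrable_of_forall_lt_abs fun x => cutoff_eq_zero)
  have hφc : Continuous φ := continuous_iff_continuousAt.2 fun y => (hφ y).continuousAt
  have hM0 : 0 ≤ M := (abs_nonneg _).trans (hM 0)
  have hA := fun t (ht : 0 < t) => hasDerivAt_integral_weight_mul (e := p) (p := s)
    hφ hg hcp hcs
    (h := fun t x => 2 * b t x * at' t x / lagr (a t x) (b t x)
      + (1 - b t x ^ 2) * (a t x * ax t x - b t x * at' t x) / lagr (a t x) (b t x) ^ 3)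
    (by unfold Function.uncurry; fun_prop (disch := first | exact hL0 | exact hL3))
    (fun t x => (hasDerivAt_momentumDensity (hat t x) (hbt t x) (hsmall t x)).congr_deriv
      (momentum_balance (hsmall t x) (hpde t x)))
    (fun t x => hasDerivAt_stressDensity (hax t x) (hbx t x) (hsmall t x)) hsps ht
  have hB := fun t (ht : 0 < t) => hasDerivAt_integral_weight_mul (e := e) (p := p)
    hasDerivAt_cutoff_sq (by fun_prop) hce hcp
    (h := fun t x => (ax t x * b t x + a t x * at' t x) / lagr (a t x) (b t x)
      - a t x * b t x * (a t x * ax t x - b t x * at' t x) / lagr (a t x) (b t x) ^ 3)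
    (by unfold Function.uncurry; fun_prop (disch := first | exact hL0 | exact hL3))
    (fun t x => (hasDerivAt_energyDensity (hat t x) (hbt t x) (hsmall t x)).congr_deriv
      (energy_balance (hsmall t x) (hpde t x)))
    (fun t x => hasDerivAt_momentumDensity (hax t x) (hbx t x) (hsmall t x)) hsep ht
  have he_nonneg : ∀ t x, 0 ≤ e t x := fun t x =>
    le_trans (by positivity) (energyDensity_mem (hsmall t x)).1
  have hQi : ∀ t, Integrable fun x => cutoff (x / t) * q t x := fun t =>
    hmul t (by fun_prop) (hcq t) fun x => id
  have hBi : ∀ t, Integrable fun x => cutoff (x / t) ^ 2 * e t x := fun t =>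
    hmul t (by fun_prop) (hslice hce t) (he0 t)
  have hlim := tendsto_zero_of_virial (Q := fun t => ∫ x, cutoff (x / t) * q t x)
    (M := M * m) (c := 1 / 5) (K := 2) (by norm_num) (by norm_num) hA hB ?_ ?_ ?_ ?_ ?_
  · refine squeeze_zero' (Eventually.of_forall fun t => integral_nonneg fun x => hq0 t x) ?_
      (by simpa using hlim.const_mul (1024 / 9))
    filter_upwards [eventually_gt_atTop 0] with t ht
    calc ∫ x in Set.Icc (-(t / 4)) (t / 4), q t x
        ≤ ∫ x in Set.Icc (-(t / 4)) (t / 4), 1024 / 9 * (cutoff (x / t) ^ 2 * e t x) := by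
          refine setIntegral_mono_on (hqi t).integrableOn ((hBi t).const_mul _).integrableOn
            measurableSet_Icc fun x hx => ?_
          have hc : 3 / 16 ≤ cutoff (x / t) := by
            refine le_cutoff ?_
            rw [abs_div, abs_of_pos ht, div_le_iff₀ ht, abs_le]
            constructor <;> linarith [hx.1, hx.2]
          have h1 : 9 / 256 ≤ cutoff (x / t) ^ 2 := by nlinarith
          have h2 := mul_le_mul h1 (energyDensity_mem (hsmall t x)).1
            (by positivity) (by positivity)
          simp only [hq, he]
          linarith
      _ ≤ ∫ x, 1024 / 9 * (cutoff (x / t) ^ 2 * e t x) :=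
          setIntegral_le_integral ((hBi t).const_mul _) (Eventually.of_forall fun x => by
            have := he_nonneg t x
            positivity)
      _ = 1024 / 9 * ∫ x, cutoff (x / t) ^ 2 * e t x := integral_const_mul _ _
  · intro t ht
    have h1 : 1 / 5 * ∫ x, cutoff (x / t) * q t x
        ≤ ∫ x, cutoff (x / t) * (s t x + x / t * p t x) := by
      rw [← integral_const_mul]
      refine integral_mono ((hQi t).const_mul _) (hmul t (by fun_prop)
        ((hslice hcs t).add ((continuous_id.div_const t).mul (hslice hcp t)))
        fun x hx => by simp [hs0 t x hx, hp0 t x hx]) fun x => ?_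
      rcases le_or_gt |x / t| (1 / 2) with hx | hx
      · have := mul_le_mul_of_nonneg_left (le_stressDensity_add (hsmall t x) hx)
          (cutoff_nonneg (x / t))
        simp only [hq, hs_def, hp]
        linarith
      · simp [cutoff_eq_zero hx]
    have h2 := mul_le_mul_of_nonneg_left h1 (one_div_pos.2 ht).le
    calc -(1 / t * _) ≤ -(1 / t * (1 / 5 * ∫ x, cutoff (x / t) * q t x)) := neg_le_neg h2
      _ = _ := by ring
  · intro t ht
    have h1 : -∫ x, -(4 * (x / t) * cutoff (x / t)) * (p t x + x / t * e t x)
        ≤ 2 * ∫ x, cutoff (x / t) * q t x := by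
      rw [← integral_const_mul, ← integral_neg]
      refine integral_mono (hmul t (by fun_prop)
        ((hslice hcp t).add ((continuous_id.div_const t).mul (hslice hce t)))
        fun x hx => by simp [he0 t x hx, hp0 t x hx]).neg ((hQi t).const_mul _) fun x => ?_
      rcases le_or_gt |x / t| (1 / 2) with hx | hx
      · have h3 : |x / t * (p t x + x / t * e t x)| ≤ 1 / 2 * q t x := by
          rw [abs_mul]
          exact mul_le_mul hx (abs_momentumDensity_add_le (hsmall t x) hx) (abs_nonneg _)
            (by norm_num)
        have := mul_le_mul_of_nonneg_left (abs_le.1 h3).2 (cutoff_nonneg (x / t))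
        simp only
        linarith
      · simp [cutoff_eq_zero hx]
    have h2 := mul_le_mul_of_nonneg_left h1 (one_div_pos.2 ht).le
    calc -(1 / t * _) = 1 / t * -_ := (mul_neg _ _).symm
      _ ≤ _ := h2
      _ = _ := by ring
  · exact fun t ht => integral_nonneg fun x => mul_nonneg (sq_nonneg _) (he_nonneg t x)
  · refine fun t ht => integral_mono (hBi t) (hQi t) fun x => ?_
    have h1 := (energyDensity_mem (hsmall t x)).2
    have h2 := cutoff_nonneg (x / t)
    have h3 : cutoff (x / t) ^ 2 ≤ cutoff (x / t) := by nlinarith [cutoff_le (x / t)]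
    exact mul_le_mul h3 (h1.trans (by linarith [hq0 t x])) (he_nonneg t x) h2
  · intro t ht
    calc |∫ x, φ (x / t) * p t x| ≤ ∫ x, |φ (x / t) * p t x| := abs_integral_le_integral_abs
      _ ≤ ∫ x, M * q t x := by
          refine integral_mono (hmul t (by fun_prop) (hslice hcp t) (hp0 t)).abs
            ((hqi t).const_mul M) fun x => ?_
          simp only [abs_mul]
          exact mul_le_mul (hM _) ((abs_momentumDensity_le (hsmall t x)).trans
            (by linarith [hq0 t x])) (abs_nonneg _) hM0
      _ = M * ∫ x, q t x := integral_const_mul _ _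
      _ ≤ M * m := mul_le_mul_of_nonneg_left (hint t) hM0

/-! ### Partial derivatives of a `C²` field -/

section Partials

variable {f : ℝ × ℝ → ℝ}

lemma DifferentiableAt.hasDerivAt_fst {t x : ℝ} (hf : DifferentiableAt ℝ f (t, x)) :
    HasDerivAt (fun s => f (s, x)) (fderiv ℝ f (t, x) (1, 0)) t :=
  hf.hasFDerivAt.comp_hasDerivAt t ((hasDerivAt_id t).prodMk (hasDerivAt_const t x))

lemma DifferentiableAt.hasDerivAt_snd {t x : ℝ} (hf : DifferentiableAt ℝ f (t, x)) :
    HasDerivAt (fun y => f (t, y)) (fderiv ℝ f (t, x) (0, 1)) x :=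
  hf.hasFDerivAt.comp_hasDerivAt x ((hasDerivAt_const x t).prodMk (hasDerivAt_id x))

lemma ContDiff.fderiv_apply_const (hf : ContDiff ℝ 2 f) (v : ℝ × ℝ) :
    ContDiff ℝ 1 fun z => fderiv ℝ f z v :=
  (hf.fderiv_right (by norm_num)).clm_apply contDiff_const

lemma ContDiff.fderiv_fderiv_apply_comm (hf : ContDiff ℝ 2 f) (v w z : ℝ × ℝ) :
    fderiv ℝ (fun z => fderiv ℝ f z v) z w = fderiv ℝ (fun z => fderiv ℝ f z w) z v := by
  have hd : DifferentiableAt ℝ (fderiv ℝ f) z :=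
    (hf.fderiv_right (m := 1) (by norm_num)).differentiable (by norm_num) z
  have h : ∀ v w, fderiv ℝ (fun z => fderiv ℝ f z v) z w = fderiv ℝ (fderiv ℝ f) z w v := by
    intro v w
    rw [fderiv_clm_apply hd (differentiableAt_const v)]
    simp
  rw [h, h]
  exact hf.contDiffAt.isSymmSndFDerivAt (by simp) w v

end Partials

/-- Main Theorem (Theorem 1.1, forward-time version): for any `C > 0` and `ε` sufficiently
small, any global small C² solution of Born–Infeld satisfies
`∫_{I(t)} ((∂ₓu)² + (∂ₜu)²)(t,x) dx → 0` as `t → +∞`, where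
`I(t) = (-C t/(log t)², C t/(log t)²)`. -/
theorem BI_decay_main :
    ∃ ε₀ : ℝ, 0 < ε₀ ∧ ∀ C : ℝ, 0 < C → ∀ ε : ℝ, 0 < ε → ε ≤ ε₀ →
    ∀ u : ℝ × ℝ → ℝ, ContDiff ℝ 2 u → IsBISol u →
    (∀ t x : ℝ, |ux u t x| + |ut u t x| ≤ ε) →
    (∀ t : ℝ, ∫ x : ℝ, ((ux u t x) ^ 2 + (ut u t x) ^ 2) ≤ ε ^ 2) →
    (∀ T : ℝ, ∃ R : ℝ, ∀ t x : ℝ, |t| ≤ T → R ≤ |x| → ux u t x = 0 ∧ ut u t x = 0) →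
    Tendsto (fun t : ℝ => ∫ x in Set.Ioo (-(lam C t)) (lam C t),
        ((ux u t x) ^ 2 + (ut u t x) ^ 2)) atTop (nhds 0) := by
  refine ⟨1 / 10, by norm_num, fun C hC ε _ hε₀ u hu hsol hsmall hint hsupp => ?_⟩
  have hux : ∀ t x, ux u t x = fderiv ℝ u (t, x) (0, 1) := fun t x =>
    (hu.differentiable (by norm_num) (t, x)).hasDerivAt_snd.deriv
  have hut : ∀ t x, ut u t x = fderiv ℝ u (t, x) (1, 0) := fun t x =>
    (hu.differentiable (by norm_num) (t, x)).hasDerivAt_fst.deriv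
  have ha := hu.fderiv_apply_const (0, 1)
  have hb := hu.fderiv_apply_const (1, 0)
  have hax : ∀ t x, HasDerivAt (fun y => ux u t y) (uxx u t x) x := fun t x => by
    have h := (ha.differentiable (by norm_num) (t, x)).hasDerivAt_snd
    simp only [← hux] at h
    exact h.differentiableAt.hasDerivAt
  have hat : ∀ t x, HasDerivAt (fun s => ux u s x) (utx u t x) t := fun t x => by
    have h := (ha.differentiable (by norm_num) (t, x)).hasDerivAt_fst
    simp only [← hux] at h
    exact h.differentiableAt.hasDerivAt
  have hbt : ∀ t x, HasDerivAt (fun s => ut u s x) (utt u t x) t := fun t x => by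
    have h := (hb.differentiable (by norm_num) (t, x)).hasDerivAt_fst
    simp only [← hut] at h
    exact h.differentiableAt.hasDerivAt
  have huxx : ∀ t x, uxx u t x = fderiv ℝ (fun z => fderiv ℝ u z (0, 1)) (t, x) (0, 1) :=
    fun t x => by
      simpa only [uxx, hux] using (ha.differentiable (by norm_num) (t, x)).hasDerivAt_snd.deriv
  have hutx : ∀ t x, utx u t x = fderiv ℝ (fun z => fderiv ℝ u z (0, 1)) (t, x) (1, 0) :=
    fun t x => by
      simpa only [utx, hux] using (ha.differentiable (by norm_num) (t, x)).hasDerivAt_fst.deriv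
  have hbx : ∀ t x, HasDerivAt (fun y => ut u t y) (utx u t x) x := fun t x => by
    have h := (hb.differentiable (by norm_num) (t, x)).hasDerivAt_snd
    rwa [hu.fderiv_fderiv_apply_comm, ← hutx, ← funext (hut t)] at h
  have hca : Continuous (Function.uncurry (ux u)) := by
    simpa only [Function.uncurry_def, hux] using ha.continuous
  have hcb : Continuous (Function.uncurry (ut u)) := by
    simpa only [Function.uncurry_def, hut] using hb.continuous
  have hcax : Continuous (Function.uncurry (uxx u)) := by
    simpa only [Function.uncurry_def, huxx] using
      (ha.continuous_fderiv (by norm_num)).clm_apply continuous_const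
  have hcat : Continuous (Function.uncurry (utx u)) := by
    simpa only [Function.uncurry_def, hutx] using
      (ha.continuous_fderiv (by norm_num)).clm_apply continuous_const
  have hcone := tendsto_integral_cone_zero hca hcb hcax hcat hax hat hbx hbt hsol
    (fun t x => (hsmall t x).trans hε₀) hint hsupp
  refine squeeze_zero' (Eventually.of_forall fun t => integral_nonneg fun x => by positivity) ?_
    hcone
  have hlog : Tendsto (fun t => C / Real.log t ^ 2) atTop (nhds 0) :=
    tendsto_const_nhds.div_atTop ((tendsto_pow_atTop two_ne_zero).comp Real.tendsto_log_atTop)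
  filter_upwards [hlog.eventually (gt_mem_nhds (by norm_num : (0 : ℝ) < 1 / 4)),
    eventually_gt_atTop 0] with t ht ht0
  have hlam : lam C t ≤ t / 4 := by
    have h : lam C t = C / Real.log t ^ 2 * t := by unfold lam; ring
    nlinarith
  have hc : Continuous fun x => ux u t x ^ 2 + ut u t x ^ 2 :=
    ((hca.comp (by fun_prop : Continuous fun x => (t, x))).pow 2).add
      ((hcb.comp (by fun_prop : Continuous fun x => (t, x))).pow 2)
  refine setIntegral_mono_set hc.continuousOn.integrableOn_Icc
    (Eventually.of_forall fun x => by positivity) (LE.le.eventuallyLE ?_)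
  exact Set.Ioo_subset_Icc_self.trans (Set.Icc_subset_Icc (neg_le_neg hlam) hlam)
end

section
/- Let u : ℝ × ℝ → ℝ be a C² solution of the Born–Infeld equation satisfying the regularity/decay and smallness hypotheses. Then for every fixed λ₀ > 0 there is a constant K > 0 (independent of u, ε, λ₀) such that ∫_2^∞ ∫_ℝ sech²(x/λ₀) ( (∂ₓu)² + (∂ₜu)² )(t,x) dx dt ≤ K λ₀ ε². -/
open MeasureTheory Real Filter

/-! ### Hyperbolic weights -/

theorem sech_sq_nonneg (x : ℝ) : 0 ≤ sech x ^ 2 := sq_nonneg _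

theorem contDiff_sech {n : WithTop ℕ∞} : ContDiff ℝ n sech :=
  contDiff_const.div Real.contDiff_cosh fun x => (Real.cosh_pos x).ne'

theorem contDiff_tanh {n : WithTop ℕ∞} : ContDiff ℝ n Real.tanh := by
  rw [show Real.tanh = fun x => Real.sinh x / Real.cosh x from funext Real.tanh_eq_sinh_div_cosh]
  exact Real.contDiff_sinh.div Real.contDiff_cosh fun x => (Real.cosh_pos x).ne'

theorem hasDerivAt_tanh (x : ℝ) : HasDerivAt Real.tanh (sech x ^ 2) x := by
  rw [show Real.tanh = fun x => Real.sinh x / Real.cosh x from funext Real.tanh_eq_sinh_div_cosh]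
  refine ((Real.hasDerivAt_sinh x).div (Real.hasDerivAt_cosh x)
    (Real.cosh_pos x).ne').congr_deriv ?_
  rw [sech, div_pow, one_pow, ← Real.cosh_sq_sub_sinh_sq x]
  ring

theorem hasDerivAt_mul_tanh_div {l : ℝ} (hl : 0 < l) (x : ℝ) :
    HasDerivAt (fun y => l * Real.tanh (y / l)) (sech (x / l) ^ 2) x := by
  refine (((hasDerivAt_tanh (x / l)).comp x
    ((hasDerivAt_id x).div_const l)).const_mul l).congr_deriv ?_
  field_simp

/-! ### Partial derivatives of a `C²` field -/

section Partials

variable {u : ℝ × ℝ → ℝ}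

theorem hasDerivAt_fst_slice {f : ℝ × ℝ → ℝ} {t x : ℝ} (hf : DifferentiableAt ℝ f (t, x)) :
    HasDerivAt (fun s => f (s, x)) (fderiv ℝ f (t, x) (1, 0)) t :=
  hf.hasFDerivAt.comp_hasDerivAt t ((hasDerivAt_id t).prodMk (hasDerivAt_const t x))

theorem hasDerivAt_snd_slice {f : ℝ × ℝ → ℝ} {t x : ℝ} (hf : DifferentiableAt ℝ f (t, x)) :
    HasDerivAt (fun y => f (t, y)) (fderiv ℝ f (t, x) (0, 1)) x :=
  hf.hasFDerivAt.comp_hasDerivAt x ((hasDerivAt_const x t).prodMk (hasDerivAt_id x))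

theorem ut_eq_fderiv (hu : Differentiable ℝ u) (t x : ℝ) : ut u t x = fderiv ℝ u (t, x) (1, 0) :=
  (hasDerivAt_fst_slice (hu _)).deriv

theorem ux_eq_fderiv (hu : Differentiable ℝ u) (t x : ℝ) : ux u t x = fderiv ℝ u (t, x) (0, 1) :=
  (hasDerivAt_snd_slice (hu _)).deriv

theorem contDiff_ut (hu : ContDiff ℝ 2 u) : ContDiff ℝ 1 fun z : ℝ × ℝ => ut u z.1 z.2 := by
  simp only [ut_eq_fderiv (hu.differentiable two_ne_zero)]
  exact (hu.fderiv_right (by norm_num)).clm_apply contDiff_const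

theorem contDiff_ux (hu : ContDiff ℝ 2 u) : ContDiff ℝ 1 fun z : ℝ × ℝ => ux u z.1 z.2 := by
  simp only [ux_eq_fderiv (hu.differentiable two_ne_zero)]
  exact (hu.fderiv_right (by norm_num)).clm_apply contDiff_const

theorem hasDerivAt_ut_fst (hu : ContDiff ℝ 2 u) (t x : ℝ) :
    HasDerivAt (fun s => ut u s x) (utt u t x) t :=
  (hasDerivAt_fst_slice ((contDiff_ut hu).differentiable one_ne_zero (t, x))).differentiableAt
    |>.hasDerivAt

theorem hasDerivAt_ux_fst (hu : ContDiff ℝ 2 u) (t x : ℝ) :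
    HasDerivAt (fun s => ux u s x) (utx u t x) t :=
  (hasDerivAt_fst_slice ((contDiff_ux hu).differentiable one_ne_zero (t, x))).differentiableAt
    |>.hasDerivAt

theorem hasDerivAt_ux_snd (hu : ContDiff ℝ 2 u) (t x : ℝ) :
    HasDerivAt (fun y => ux u t y) (uxx u t x) x :=
  (hasDerivAt_snd_slice ((contDiff_ux hu).differentiable one_ne_zero (t, x))).differentiableAt
    |>.hasDerivAt

theorem hasDerivAt_ut_snd (hu : ContDiff ℝ 2 u) (t x : ℝ) :
    HasDerivAt (fun y => ut u t y) (utx u t x) x := by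
  have hd := hu.differentiable two_ne_zero
  have hd2 : Differentiable ℝ (fderiv ℝ u) :=
    (hu.fderiv_right (m := 1) (by norm_num)).differentiable one_ne_zero
  have hsymm : IsSymmSndFDerivAt ℝ u (t, x) := hu.contDiffAt.isSymmSndFDerivAt (by simp)
  have h1 := hasDerivAt_snd_slice (t := t) (x := x)
    ((hd2.clm_apply (differentiable_const ((1 : ℝ), (0 : ℝ)))) (t, x))
  have h2 := hasDerivAt_fst_slice (t := t) (x := x)
    ((hd2.clm_apply (differentiable_const ((0 : ℝ), (1 : ℝ)))) (t, x))
  have h3 : ∀ v w : ℝ × ℝ, fderiv ℝ (fun z => fderiv ℝ u z v) (t, x) w =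
      fderiv ℝ (fderiv ℝ u) (t, x) w v := fun v w => by
    rw [fderiv_clm_apply (hd2 _) (differentiableAt_const v)]
    simp
  rw [h3] at h1 h2
  simp only [utx, ut_eq_fderiv hd, ux_eq_fderiv hd]
  rwa [h2.deriv, hsymm.eq (1, 0) (0, 1)]

end Partials

/-! ### The momentum balance law -/

/-- The Lagrangian density `√(1 + p² - q²)` of the Born–Infeld equation,
with `p = ∂ₓu` and `q = ∂ₜu`. -/
noncomputable def biLagrangian (p q : ℝ) : ℝ := √(1 + p ^ 2 - q ^ 2)

/-- The momentum density of the Born–Infeld equation. -/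
noncomputable def biMomentum (p q : ℝ) : ℝ := p * q / biLagrangian p q

/-- The flux of the Born–Infeld momentum, normalised to vanish on the zero field. -/
noncomputable def biFlux (p q : ℝ) : ℝ := 1 - (1 - q ^ 2) / biLagrangian p q

theorem HasDerivAt.biLagrangian {p q : ℝ → ℝ} {p' q' s : ℝ} (hp : HasDerivAt p p' s)
    (hq : HasDerivAt q q' s) (h : 0 < 1 + p s ^ 2 - q s ^ 2) :
    HasDerivAt (fun r => biLagrangian (p r) (q r))
      ((p s * p' - q s * q') / biLagrangian (p s) (q s)) s := by
  refine ((((hp.pow 2).const_add 1).sub (hq.pow 2)).sqrt h.ne').congr_deriv ?_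
  change _ / (2 * √(1 + p s ^ 2 - q s ^ 2)) = _ / √(1 + p s ^ 2 - q s ^ 2)
  have : √(1 + p s ^ 2 - q s ^ 2) ≠ 0 := (Real.sqrt_pos.2 h).ne'
  field_simp
  ring

theorem biMomentum_deriv_eq_biFlux_deriv {u : ℝ × ℝ → ℝ} (hu : ContDiff ℝ 2 u) (hsol : IsBISol u)
    {t x : ℝ} (h : 0 < 1 + ux u t x ^ 2 - ut u t x ^ 2) :
    deriv (fun s => biMomentum (ux u s x) (ut u s x)) t =
      deriv (fun y => biFlux (ux u t y) (ut u t y)) x := by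
  have hL : biLagrangian (ux u t x) (ut u t x) ≠ 0 := (Real.sqrt_pos.2 h).ne'
  have hL2 : biLagrangian (ux u t x) (ut u t x) ^ 2 = 1 + ux u t x ^ 2 - ut u t x ^ 2 :=
    Real.sq_sqrt h.le
  have hP := (((hasDerivAt_ux_fst hu t x).mul (hasDerivAt_ut_fst hu t x)).div
    ((hasDerivAt_ux_fst hu t x).biLagrangian (hasDerivAt_ut_fst hu t x) h) hL).deriv
  have hG := (((((hasDerivAt_ut_snd hu t x).pow 2).const_sub 1).div
    ((hasDerivAt_ux_snd hu t x).biLagrangian (hasDerivAt_ut_snd hu t x) h) hL).const_sub 1).deriv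
  refine Eq.trans hP (Eq.trans ?_ hG.symm)
  have hs := hsol t x
  simp only [Pi.mul_apply, Pi.pow_apply] at *
  generalize biLagrangian (ux u t x) (ut u t x) = L at *
  generalize ux u t x = p at *
  generalize ut u t x = q at *
  field_simp
  rw [hL2]
  push_cast
  linear_combination (-p) * hs

/-! ### Pointwise bounds for small gradients -/

section Pointwise

variable {p q : ℝ}

theorem sq_add_sq_le_of_abs_add_abs_le {ε : ℝ} (h : |p| + |q| ≤ ε) : p ^ 2 + q ^ 2 ≤ ε ^ 2 := by
  rw [← sq_abs p, ← sq_abs q]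
  nlinarith [abs_nonneg p, abs_nonneg q]

theorem le_biLagrangian (h : p ^ 2 + q ^ 2 ≤ 1 / 4) :
    1 + (p ^ 2 - q ^ 2) / 2 - (p ^ 2 - q ^ 2) ^ 2 / 4 ≤ biLagrangian p q := by
  apply Real.le_sqrt_of_sq_le
  have h1 : |p ^ 2 - q ^ 2| ≤ 1 / 4 := abs_le.2 ⟨by nlinarith, by nlinarith⟩
  obtain ⟨h2, h3⟩ := abs_le.1 h1
  have h4 : p ^ 2 - q ^ 2 + 1 = 1 + p ^ 2 - q ^ 2 := by ring
  rw [← h4]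
  generalize p ^ 2 - q ^ 2 = s at *
  nlinarith [mul_nonneg (sq_nonneg s) (show 0 ≤ 1 / 4 + s / 4 - s ^ 2 / 16 by nlinarith)]

theorem half_le_biLagrangian (h : p ^ 2 + q ^ 2 ≤ 1 / 4) : 1 / 2 ≤ biLagrangian p q :=
  Real.le_sqrt_of_sq_le (by nlinarith [sq_nonneg p, sq_nonneg q])

theorem biLagrangian_le (h : p ^ 2 + q ^ 2 ≤ 1 / 4) : biLagrangian p q ≤ 5 / 4 :=
  Real.sqrt_le_iff.2 ⟨by norm_num, by nlinarith [sq_nonneg p, sq_nonneg q]⟩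

theorem abs_biMomentum_le (h : p ^ 2 + q ^ 2 ≤ 1 / 4) : |biMomentum p q| ≤ p ^ 2 + q ^ 2 := by
  have hL := half_le_biLagrangian h
  rw [biMomentum, abs_div, abs_of_pos (by linarith : 0 < biLagrangian p q),
    div_le_iff₀ (by linarith), abs_mul, ← sq_abs p, ← sq_abs q]
  nlinarith [sq_nonneg (|p| - |q|), sq_nonneg |p|, sq_nonneg |q|]

theorem sq_add_sq_le_biFlux (h : p ^ 2 + q ^ 2 ≤ 1 / 4) : p ^ 2 + q ^ 2 ≤ 4 * biFlux p q := by
  have hL := half_le_biLagrangian h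
  have hL1 := le_biLagrangian h
  have hL2 := biLagrangian_le h
  have hpos : 0 < biLagrangian p q := by linarith
  have key : (p ^ 2 + q ^ 2) / 4 * biLagrangian p q ≤ biLagrangian p q - (1 - q ^ 2) := by
    have : (p ^ 2 - q ^ 2) ^ 2 ≤ (p ^ 2 + q ^ 2) * (1 / 4) := by
      nlinarith [mul_nonneg (sq_nonneg p) (sq_nonneg q), sq_nonneg p, sq_nonneg q]
    nlinarith [sq_nonneg p, sq_nonneg q]
  have : (p ^ 2 + q ^ 2) / 4 ≤ (biLagrangian p q - (1 - q ^ 2)) / biLagrangian p q :=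
    (le_div_iff₀ hpos).2 key
  rw [sub_div, div_self hpos.ne'] at this
  rw [biFlux]
  linarith

end Pointwise

/-! ### Integration over a rectangle -/

/-- If `∂ₜP = ∂ₓG` and `G` vanishes on the lateral boundary of a rectangle, the weighted integral of
`G` is controlled by the weighted integrals of `P` over the two ends. -/
theorem integral_deriv_mul_flux {P G : ℝ × ℝ → ℝ} {φ φ' : ℝ → ℝ} (hP : ContDiff ℝ 1 P)
    (hG : ContDiff ℝ 1 G) (hφ : ContDiff ℝ 1 φ) (hφ' : ∀ x, HasDerivAt φ (φ' x) x)
    (hPG : ∀ t x, deriv (fun s => P (s, x)) t = deriv (fun y => G (t, y)) x) {a b R : ℝ}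
    (h0 : ∀ t ∈ Set.uIcc a b, G (t, R) = 0 ∧ G (t, -R) = 0) :
    ∫ t in a..b, ∫ x in (-R)..R, φ' x * G (t, x) =
      (∫ x in (-R)..R, φ x * P (a, x)) - ∫ x in (-R)..R, φ x * P (b, x) := by
  set f : ℝ × ℝ → ℝ := fun z => φ z.2 * P z with hf
  set g : ℝ × ℝ → ℝ := fun z => -(φ z.2 * G z) with hg
  have hfc : ContDiff ℝ 1 f := (hφ.comp contDiff_snd).mul hP
  have hgc : ContDiff ℝ 1 g := ((hφ.comp contDiff_snd).mul hG).neg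
  have hfd := hfc.differentiable one_ne_zero
  have hgd := hgc.differentiable one_ne_zero
  have hdiv : ∀ t x, fderiv ℝ f (t, x) (1, 0) + fderiv ℝ g (t, x) (0, 1) = -(φ' x * G (t, x)) := by
    intro t x
    have hPt := (hasDerivAt_fst_slice (hP.differentiable one_ne_zero (t, x)))
    have hGx := (hasDerivAt_snd_slice (hG.differentiable one_ne_zero (t, x)))
    have h1 := (hasDerivAt_fst_slice (hfd (t, x))).unique (hPt.const_mul (φ x))
    have h2 := (hasDerivAt_snd_slice (hgd (t, x))).unique ((hφ' x).mul hGx).neg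
    have h3 := hPG t x
    rw [hPt.deriv, hGx.deriv] at h3
    rw [h1, h2, h3]
    ring
  have hcont : Continuous fun z : ℝ × ℝ => fderiv ℝ f z (1, 0) + fderiv ℝ g z (0, 1) :=
    ((hfc.continuous_fderiv one_ne_zero).clm_apply continuous_const).add
      ((hgc.continuous_fderiv one_ne_zero).clm_apply continuous_const)
  have key := integral2_divergence_prod_of_hasFDerivAt_off_countable f g (fderiv ℝ f) (fderiv ℝ g)
    a (-R) b R ∅ Set.countable_empty hfc.continuous.continuousOn hgc.continuous.continuousOn
    (fun z _ => (hfd z).hasFDerivAt) (fun z _ => (hgd z).hasFDerivAt)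
    (hcont.continuousOn.integrableOn_compact (isCompact_uIcc.prod isCompact_uIcc))
  have hR : ∫ t in a..b, g (t, R) = 0 := by
    rw [intervalIntegral.integral_congr (g := fun _ => 0) fun t ht => by simp [hg, (h0 t ht).1]]
    simp
  have hR' : ∫ t in a..b, g (t, -R) = 0 := by
    rw [intervalIntegral.integral_congr (g := fun _ => 0) fun t ht => by simp [hg, (h0 t ht).2]]
    simp
  simp only [hdiv, hR, hR', intervalIntegral.integral_neg] at key
  simp only [hf] at key
  linarith

/-- An iterated lower integral of a continuous nonnegative function with bounded spatial support is
the iterated interval integral. -/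
theorem lintegral_lintegral_eq_ofReal {H : ℝ × ℝ → ℝ} (hH : Continuous H) (h0 : ∀ z, 0 ≤ H z)
    {a b R : ℝ} (hab : a ≤ b) (hR : 0 ≤ R)
    (hsupp : ∀ t ∈ Set.Ioc a b, ∀ x, R ≤ |x| → H (t, x) = 0) :
    ∫⁻ t in Set.Ioc a b, ∫⁻ x, ENNReal.ofReal (H (t, x)) =
      ENNReal.ofReal (∫ t in a..b, ∫ x in (-R)..R, H (t, x)) := by
  have hRR : -R ≤ R := by linarith
  have hin : Continuous fun t => ∫ x in (-R)..R, H (t, x) :=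
    intervalIntegral.continuous_parametric_intervalIntegral_of_continuous' (by exact hH) _ _
  rw [intervalIntegral.integral_of_le hab, ofReal_integral_eq_lintegral_ofReal
    ((hin.integrableOn_Icc).mono_set Set.Ioc_subset_Icc_self)
    (Eventually.of_forall fun t => intervalIntegral.integral_nonneg hRR fun x _ => h0 _)]
  refine setLIntegral_congr_fun measurableSet_Ioc fun t ht => ?_
  have hc : Continuous fun x => H (t, x) := by fun_prop
  rw [intervalIntegral.integral_of_le hRR, ofReal_integral_eq_lintegral_ofReal
    (hc.integrableOn_Icc.mono_set Set.Ioc_subset_Icc_self) (Eventually.of_forall fun x => h0 _)]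
  refine (setLIntegral_eq_of_support_subset ?_).symm
  intro x hx
  by_contra hmem
  refine hx ?_
  have : R ≤ |x| := by
    by_contra! hlt
    exact hmem ⟨(abs_lt.1 hlt).1, (abs_lt.1 hlt).2.le⟩
  simp [hsupp t ht x this]

theorem lintegral_Ioi_le_of_forall_Ioc_le {F : ℝ → ENNReal} {a : ℝ} {C : ENNReal}
    (h : ∀ b, a ≤ b → ∫⁻ t in Set.Ioc a b, F t ≤ C) : ∫⁻ t in Set.Ioi a, F t ≤ C := by
  have hU : Set.Ioi a = ⋃ n : ℕ, Set.Ioc a (a + n) := by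
    ext t
    simp only [Set.mem_Ioi, Set.mem_iUnion, Set.mem_Ioc, exists_and_left]
    refine ⟨fun ht => ⟨ht, ?_⟩, fun ht => ht.1⟩
    obtain ⟨n, hn⟩ := exists_nat_ge (t - a)
    exact ⟨n, by linarith⟩
  rw [hU, setLIntegral_iUnion_of_directed]
  · exact iSup_le fun n => h _ (by simp)
  · refine directed_of_isDirected_le fun m n hmn => Set.Ioc_subset_Ioc_right ?_
    simpa using hmn

/-- The weighted momentum at a fixed time is bounded by the energy. -/
theorem abs_integral_mul_biMomentum_le {u : ℝ × ℝ → ℝ} (hu : ContDiff ℝ 2 u) {l E R t : ℝ}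
    (hR : 0 ≤ R) {φ : ℝ → ℝ} (hφ : ∀ x, |φ x| ≤ l)
    (hsmall : ∀ x, ux u t x ^ 2 + ut u t x ^ 2 ≤ 1 / 4)
    (hE : ∫ x : ℝ, (ux u t x ^ 2 + ut u t x ^ 2) ≤ E)
    (hsupp : ∀ x, R ≤ |x| → ux u t x = 0 ∧ ut u t x = 0) :
    |∫ x in (-R)..R, φ x * biMomentum (ux u t x) (ut u t x)| ≤ l * E := by
  have hl : 0 ≤ l := (abs_nonneg _).trans (hφ 0)
  have hRR : -R ≤ R := by linarith
  have hcx : Continuous fun x => ux u t x :=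
    (contDiff_ux hu).continuous.comp (Continuous.prodMk_right t)
  have hct : Continuous fun x => ut u t x :=
    (contDiff_ut hu).continuous.comp (Continuous.prodMk_right t)
  have hc : Continuous fun x => ux u t x ^ 2 + ut u t x ^ 2 := by fun_prop
  have hint : Integrable fun x => ux u t x ^ 2 + ut u t x ^ 2 :=
    hc.integrable_of_hasCompactSupport <| HasCompactSupport.intro (isCompact_Icc (a := -R) (b := R))
      fun x hx => by
        have : R ≤ |x| := by
          by_contra! hlt
          exact hx ⟨(abs_lt.1 hlt).1.le, (abs_lt.1 hlt).2.le⟩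
        simp [hsupp x this]
  calc |∫ x in (-R)..R, φ x * biMomentum (ux u t x) (ut u t x)|
      ≤ ∫ x in (-R)..R, l * (ux u t x ^ 2 + ut u t x ^ 2) := by
        rw [← Real.norm_eq_abs]
        refine intervalIntegral.norm_integral_le_of_norm_le (μ := volume) hRR
          (Eventually.of_forall fun x _ => ?_)
          ((continuous_const.mul hc).intervalIntegrable _ _)
        rw [Real.norm_eq_abs, abs_mul]
        exact mul_le_mul (hφ x) (abs_biMomentum_le (hsmall x)) (abs_nonneg _) hl
    _ = l * ∫ x in Set.Ioc (-R) R, (ux u t x ^ 2 + ut u t x ^ 2) := by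
        rw [intervalIntegral.integral_const_mul, intervalIntegral.integral_of_le hRR]
    _ ≤ l * E := by
        refine mul_le_mul_of_nonneg_left ((setIntegral_le_integral hint ?_).trans hE) hl
        exact Eventually.of_forall fun x => by positivity

/-- Better decay estimate with a fixed scale `λ₀ > 0`:
`∫_2^∞ ∫ sech²(x/λ₀) ((∂ₓu)² + (∂ₜu)²) dx dt ≤ K λ₀ ε²` with `K` independent of `u`, `ε`, `λ₀`. -/
theorem fixed_scale_decay :
    ∃ ε₀ : ℝ, 0 < ε₀ ∧ ∃ K : ℝ, 0 < K ∧ ∀ lam₀ : ℝ, 0 < lam₀ → ∀ ε : ℝ, 0 < ε → ε ≤ ε₀ →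
    ∀ u : ℝ × ℝ → ℝ, ContDiff ℝ 2 u → IsBISol u →
    (∀ t x : ℝ, |ux u t x| + |ut u t x| ≤ ε) →
    (∀ t : ℝ, ∫ x : ℝ, ((ux u t x) ^ 2 + (ut u t x) ^ 2) ≤ ε ^ 2) →
    (∀ T : ℝ, ∃ R : ℝ, ∀ t x : ℝ, |t| ≤ T → R ≤ |x| → ux u t x = 0 ∧ ut u t x = 0) →
      ∫⁻ t in Set.Ioi (2 : ℝ), ∫⁻ x : ℝ, ENNReal.ofReal
          ((sech (x / lam₀)) ^ 2 * ((ux u t x) ^ 2 + (ut u t x) ^ 2))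
        ≤ ENNReal.ofReal (K * lam₀ * ε ^ 2) := by
  refine ⟨1 / 2, by norm_num, 8, by norm_num, ?_⟩
  intro l hl ε hε hε₀ u hu hsol hsmall hE hsupp
  have hquart : ∀ t x, ux u t x ^ 2 + ut u t x ^ 2 ≤ 1 / 4 := fun t x =>
    (sq_add_sq_le_of_abs_add_abs_le (hsmall t x)).trans (by nlinarith)
  have hpos : ∀ t x, 0 < 1 + ux u t x ^ 2 - ut u t x ^ 2 := fun t x => by
    nlinarith [hquart t x, sq_nonneg (ux u t x)]
  have hLc : ContDiff ℝ 1 fun z : ℝ × ℝ => biLagrangian (ux u z.1 z.2) (ut u z.1 z.2) :=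
    ((contDiff_const.add ((contDiff_ux hu).pow 2)).sub ((contDiff_ut hu).pow 2)).sqrt
      fun z => (hpos z.1 z.2).ne'
  have hL0 : ∀ z : ℝ × ℝ, biLagrangian (ux u z.1 z.2) (ut u z.1 z.2) ≠ 0 := fun z =>
    (Real.sqrt_pos.2 (hpos z.1 z.2)).ne'
  have hPc : ContDiff ℝ 1 fun z : ℝ × ℝ => biMomentum (ux u z.1 z.2) (ut u z.1 z.2) :=
    ((contDiff_ux hu).mul (contDiff_ut hu)).div hLc hL0
  have hGc : ContDiff ℝ 1 fun z : ℝ × ℝ => biFlux (ux u z.1 z.2) (ut u z.1 z.2) :=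
    contDiff_const.sub ((contDiff_const.sub ((contDiff_ut hu).pow 2)).div hLc hL0)
  have hφc : ContDiff ℝ 1 fun x => l * Real.tanh (x / l) :=
    contDiff_const.mul (contDiff_tanh.comp (contDiff_id.div_const l))
  have hφb : ∀ x, |l * Real.tanh (x / l)| ≤ l := fun x => by
    rw [abs_mul, abs_of_pos hl]
    exact mul_le_of_le_one_right hl.le (Real.abs_tanh_lt_one _).le
  refine lintegral_Ioi_le_of_forall_Ioc_le fun T hT => ?_
  obtain ⟨R₀, hR₀⟩ := hsupp T
  obtain ⟨R, hR, hRR₀⟩ : ∃ R, 0 ≤ R ∧ R₀ ≤ R := ⟨max R₀ 0, le_max_right _ _, le_max_left _ _⟩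
  have hzero : ∀ t ∈ Set.Icc 2 T, ∀ x, R ≤ |x| → ux u t x = 0 ∧ ut u t x = 0 := fun t ht x hx =>
    hR₀ t x (by rw [abs_of_nonneg (by linarith [ht.1])]; exact ht.2) (hRR₀.trans hx)
  have hflux0 : ∀ t ∈ Set.Icc 2 T, ∀ x, R ≤ |x| → biFlux (ux u t x) (ut u t x) = 0 :=
    fun t ht x hx => by simp [hzero t ht x hx, biFlux, biLagrangian]
  set H : ℝ × ℝ → ℝ := fun z => 4 * (sech (z.2 / l) ^ 2 * biFlux (ux u z.1 z.2) (ut u z.1 z.2))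
    with hH
  have hHc : Continuous H := continuous_const.mul
    ((((contDiff_sech (n := 0)).continuous.comp (continuous_snd.div_const l)).pow 2).mul
      hGc.continuous)
  have hH0 : ∀ z, 0 ≤ H z := fun z => by
    have := (by positivity : 0 ≤ ux u z.1 z.2 ^ 2 + ut u z.1 z.2 ^ 2).trans
      (sq_add_sq_le_biFlux (hquart z.1 z.2))
    exact mul_nonneg (by norm_num) (mul_nonneg (sech_sq_nonneg _) (by linarith))
  have hbal := integral_deriv_mul_flux hPc hGc hφc (hasDerivAt_mul_tanh_div hl)
    (fun t x => biMomentum_deriv_eq_biFlux_deriv hu hsol (hpos t x)) (a := 2) (b := T) (R := R)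
    (fun t ht => by
      rw [Set.uIcc_of_le hT] at ht
      exact ⟨hflux0 t ht R (le_abs_self R), hflux0 t ht (-R) (by simpa using le_abs_self R)⟩)
  have hend : ∀ t ∈ Set.Icc 2 T, _ := fun t ht =>
    abs_le.1 (abs_integral_mul_biMomentum_le hu hR hφb (hquart t) (hE t) (hzero t ht))
  have h2 := (hend 2 ⟨le_rfl, hT⟩).2
  have hT' := (hend T ⟨hT, le_rfl⟩).1
  calc _ ≤ ∫⁻ t in Set.Ioc 2 T, ∫⁻ x, ENNReal.ofReal (H (t, x)) := by
        refine lintegral_mono fun t => lintegral_mono fun x => ENNReal.ofReal_le_ofReal ?_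
        have := mul_le_mul_of_nonneg_left (sq_add_sq_le_biFlux (hquart t x))
          (sech_sq_nonneg (x / l))
        simp only [hH]
        linarith
    _ = ENNReal.ofReal (∫ t in 2..T, ∫ x in (-R)..R, H (t, x)) :=
        lintegral_lintegral_eq_ofReal hHc hH0 hT hR fun t ht x hx => by
          simp [hH, hflux0 t (Set.Ioc_subset_Icc_self ht) x hx]
    _ ≤ ENNReal.ofReal (8 * l * ε ^ 2) := by
        refine ENNReal.ofReal_le_ofReal ?_
        simp only [hH, intervalIntegral.integral_const_mul]
        rw [hbal]
        linarith
end
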